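/- For all polygonal domains P₁ (with n edges) and P₂ (with m edges), both contained in (0,1)², there exists a finite sequence of snip, reset and undo operations (with undo stack of size 1) in the disconnected two-tool snip model leading from the initial configuration to a configuration in which T₁ realizes P₁ and T₂ realizes P₂ simultaneously. -/

import Mathlib

open Set

/-- The plane. -/
abbrev Plane := ℝ × ℝ

/-- A rigid motion of the plane: `g x = R x + v` with `R ∈ SO(2)`. -/
def IsRigidMotion (g : Plane → Plane) : Prop :=
  ∃ θ : ℝ, ∃ v : Plane, ∀ p : Plane,
    g p = (Real.cos θ * p.1 - Real.sin θ * p.2 + v.1,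
           Real.sin θ * p.1 + Real.cos θ * p.2 + v.2)

/-- The open unit square `(0,1)²`. -/
def UnitSq : Set Plane := Ioo (0:ℝ) 1 ×ˢ Ioo (0:ℝ) 1

/-- A tool `T` realizes the shape `P` if `T` is the image of `P` under a rigid motion. -/
def Realizes (T P : Set Plane) : Prop := ∃ g, IsRigidMotion g ∧ T = g '' P

/-- A polygonal domain with `n` edges: a nonempty bounded regular-open set whose
frontier is contained in a union of `n` closed line segments. -/
def IsPolygonalDomain (P : Set Plane) (n : ℕ) : Prop :=
  P.Nonempty ∧ Bornology.IsBounded P ∧ P = interior (closure P) ∧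
  ∃ s : Fin n → Plane × Plane, frontier P ⊆ ⋃ i, segment ℝ (s i).1 (s i).2

/-- A configuration of the two-tool model with undo stacks: each tool has a current
shape and a stack (list) of its most recent previous shapes. -/
structure UConfig where
  T₁ : Set Plane
  S₁ : List (Set Plane)
  T₂ : Set Plane
  S₂ : List (Set Plane)

/-- One operation (snip, reset or undo) in the disconnected two-tool snip model
with undo stacks of size `k`: snips and resets push the replaced shape onto the
tool's stack (keeping at most `k` entries); an undo pops the stack. -/
inductive DUStep (k : ℕ) : UConfig → UConfig → Prop
  | snip1 (g : Plane → Plane) (hg : IsRigidMotion g) (c : UConfig) :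
      DUStep k c ⟨c.T₁ \ closure (g '' c.T₂), List.take k (c.T₁ :: c.S₁), c.T₂, c.S₂⟩
  | snip2 (g : Plane → Plane) (hg : IsRigidMotion g) (c : UConfig) :
      DUStep k c ⟨c.T₁, c.S₁, c.T₂ \ closure (g '' c.T₁), List.take k (c.T₂ :: c.S₂)⟩
  | reset1 (c : UConfig) : DUStep k c ⟨UnitSq, List.take k (c.T₁ :: c.S₁), c.T₂, c.S₂⟩
  | reset2 (c : UConfig) : DUStep k c ⟨c.T₁, c.S₁, UnitSq, List.take k (c.T₂ :: c.S₂)⟩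
  | undo1 (P : Set Plane) (rest : List (Set Plane)) (T₂ : Set Plane)
      (S₂ : List (Set Plane)) (T₁ : Set Plane) :
      DUStep k ⟨T₁, P :: rest, T₂, S₂⟩ ⟨P, rest, T₂, S₂⟩
  | undo2 (P : Set Plane) (rest : List (Set Plane)) (T₁ : Set Plane)
      (S₁ : List (Set Plane)) (T₂ : Set Plane) :
      DUStep k ⟨T₁, S₁, T₂, P :: rest⟩ ⟨T₁, S₁, P, rest⟩

/-- `DUReach k s c c'` : configuration `c'` is reachable from `c` by exactly `s`
operations (snip, reset or undo), with undo stacks of size `k`. -/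
inductive DUReach (k : ℕ) : ℕ → UConfig → UConfig → Prop
  | refl (c : UConfig) : DUReach k 0 c c
  | step {s : ℕ} {c c' c'' : UConfig} :
      DUStep k c c' → DUReach k s c' c'' → DUReach k (s + 1) c c''

theorem isOpen_unitSq : IsOpen UnitSq := isOpen_Ioo.prod isOpen_Ioo

/-! ### Rigid motions and polar coordinates -/

/-- The rigid motion rotating by `θ` and then translating by `v`. -/
noncomputable def rigid (θ : ℝ) (v p : Plane) : Plane :=
  (Real.cos θ * p.1 - Real.sin θ * p.2 + v.1, Real.sin θ * p.1 + Real.cos θ * p.2 + v.2)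

/-- The point with polar coordinates `(t, θ)` around `c`. -/
noncomputable def polarPt (c : Plane) (t θ : ℝ) : Plane :=
  (c.1 + t * Real.cos θ, c.2 + t * Real.sin θ)

theorem isRigidMotion_rigid (θ : ℝ) (v : Plane) : IsRigidMotion (rigid θ v) :=
  ⟨θ, v, fun _ => rfl⟩

theorem IsRigidMotion.exists_eq_rigid {g : Plane → Plane} (hg : IsRigidMotion g) :
    ∃ θ v, g = rigid θ v := by
  obtain ⟨θ, v, h⟩ := hg
  exact ⟨θ, v, funext h⟩

theorem rigid_zero : rigid 0 0 = id := by
  funext p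
  simp [rigid]

theorem rigid_rigid (θ θ' : ℝ) (v v' p : Plane) :
    rigid θ v (rigid θ' v' p) = rigid (θ + θ') (rigid θ v v') p := by
  simp only [rigid, Real.cos_add, Real.sin_add]
  ext <;> ring

theorem IsRigidMotion.comp {g h : Plane → Plane} (hg : IsRigidMotion g) (hh : IsRigidMotion h) :
    IsRigidMotion (g ∘ h) := by
  obtain ⟨θ, v, rfl⟩ := hg.exists_eq_rigid
  obtain ⟨θ', v', rfl⟩ := hh.exists_eq_rigid
  exact (funext fun p => rigid_rigid θ θ' v v' p :
    rigid θ v ∘ rigid θ' v' = _) ▸ isRigidMotion_rigid _ _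

theorem isRigidMotion_id : IsRigidMotion id := rigid_zero ▸ isRigidMotion_rigid 0 0

theorem continuous_rigid (θ : ℝ) (v : Plane) : Continuous (rigid θ v) := by
  unfold rigid
  fun_prop

/-- A rigid motion as a homeomorphism of the plane. -/
noncomputable def rigidHomeo (θ : ℝ) (v : Plane) : Plane ≃ₜ Plane where
  toFun := rigid θ v
  invFun := rigid (-θ) (rigid (-θ) 0 (-v))
  left_inv p := by
    have := Real.sin_sq_add_cos_sq θ
    simp only [rigid, Real.cos_neg, Real.sin_neg, Prod.fst_neg, Prod.snd_neg, Prod.fst_zero,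
      Prod.snd_zero]
    ext <;> grind
  right_inv p := by
    have := Real.sin_sq_add_cos_sq θ
    simp only [rigid, Real.cos_neg, Real.sin_neg, Prod.fst_neg, Prod.snd_neg, Prod.fst_zero,
      Prod.snd_zero]
    ext <;> grind
  continuous_toFun := continuous_rigid _ _
  continuous_invFun := continuous_rigid _ _

@[simp] theorem coe_rigidHomeo (θ : ℝ) (v : Plane) : ⇑(rigidHomeo θ v) = rigid θ v := rfl

theorem closure_image_rigid (θ : ℝ) (v : Plane) (s : Set Plane) :
    closure (rigid θ v '' s) = rigid θ v '' closure s :=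
  ((rigidHomeo θ v).image_closure s).symm

theorem rigid_polarPt (φ t θ : ℝ) (c d : Plane) :
    rigid φ c (polarPt d t θ) = polarPt (rigid φ c d) t (φ + θ) := by
  simp only [rigid, polarPt, Real.cos_add, Real.sin_add]
  ext <;> ring

theorem rigid_polarPt_zero (φ t θ : ℝ) (c : Plane) :
    rigid φ c (polarPt 0 t θ) = polarPt c t (φ + θ) := by
  rw [rigid_polarPt]
  simp [rigid]

theorem exists_polarPt (c p : Plane) :
    ∃ t θ, 0 ≤ t ∧ θ ∈ Ioc (-Real.pi) Real.pi ∧ p = polarPt c t θ ∧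
      t ≤ |p.1 - c.1| + |p.2 - c.2| := by
  set z : ℂ := ⟨p.1 - c.1, p.2 - c.2⟩
  have h1 := Complex.norm_mul_cos_arg z
  have h2 := Complex.norm_mul_sin_arg z
  refine ⟨‖z‖, z.arg, norm_nonneg _, ⟨Complex.neg_pi_lt_arg z, Complex.arg_le_pi z⟩, ?_,
    Complex.norm_le_abs_re_add_abs_im z⟩
  simp only [polarPt, h1, h2]
  ext <;> simp [z]

theorem continuous_polarPt (c : Plane) : Continuous fun q : ℝ × ℝ => polarPt c q.1 q.2 := by
  unfold polarPt
  fun_prop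

theorem dist_polarPt_le (c : Plane) {t : ℝ} (ht : 0 ≤ t) (θ : ℝ) : dist (polarPt c t θ) c ≤ t := by
  have h1 := Real.abs_cos_le_one θ
  have h2 := Real.abs_sin_le_one θ
  rw [Prod.dist_eq, Real.dist_eq, Real.dist_eq]
  simp only [polarPt, add_sub_cancel_left, abs_mul, abs_of_nonneg ht]
  exact max_le (by nlinarith) (by nlinarith)

theorem polarPt_isPreconnected (c : Plane) (a b r : ℝ) :
    IsPreconnected ((fun q : ℝ × ℝ => polarPt c q.1 q.2) '' (Ioo 0 r ×ˢ Ioo a b)) :=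
  (isPreconnected_Ioo.prod isPreconnected_Ioo).image _ (continuous_polarPt c).continuousOn

/-! ### Local structure of polygonal sets -/

/-- The frontier of `P` is contained in finitely many segments. -/
def HasPolygonalFrontier (P : Set Plane) : Prop :=
  ∃ (n : ℕ) (s : Fin n → Plane × Plane), frontier P ⊆ ⋃ i, segment ℝ (s i).1 (s i).2

/-- Within distance `r` of `c`, the set `F` meets only isolated directions from `c`. -/
def LocallyRadial (F : Set Plane) (c : Plane) (r : ℝ) : Prop :=
  ∀ θ₀ : ℝ, ∃ δ > 0, ∀ θ, θ ≠ θ₀ → |θ - θ₀| < δ → ∀ t ∈ Ioo 0 r, polarPt c t θ ∉ F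

theorem exists_direction_ne {d : Plane} (hd : d ≠ 0) (θ₀ : ℝ) :
    ∃ δ > 0, ∀ θ, θ ≠ θ₀ → |θ - θ₀| < δ → Real.cos θ * d.2 - Real.sin θ * d.1 ≠ 0 := by
  by_cases h0 : Real.cos θ₀ * d.2 - Real.sin θ₀ * d.1 = 0
  · refine ⟨Real.pi, Real.pi_pos, fun θ hne hlt h => ?_⟩
    obtain ⟨k, rfl⟩ : ∃ k, θ = θ₀ + k := ⟨θ - θ₀, by ring⟩
    rw [add_sub_cancel_left, abs_lt] at hlt
    have hs : Real.sin k ≠ 0 := by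
      rcases lt_trichotomy k 0 with hk | hk | hk
      · exact (Real.sin_neg_of_neg_of_neg_pi_lt hk hlt.1).ne
      · simp [hk] at hne
      · exact (Real.sin_pos_of_pos_of_lt_pi hk hlt.2).ne'
    rw [Real.cos_add, Real.sin_add] at h
    have h1 : Real.sin k * (Real.sin θ₀ * d.2 + Real.cos θ₀ * d.1) = 0 := by
      linear_combination Real.cos k * h0 - h
    have h2 := (mul_eq_zero.1 h1).resolve_left hs
    have := Real.sin_sq_add_cos_sq θ₀
    apply hd
    ext
    · simp only [Prod.fst_zero]
      linear_combination Real.cos θ₀ * h2 - Real.sin θ₀ * h0 - d.1 * this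
    · simp only [Prod.snd_zero]
      linear_combination Real.sin θ₀ * h2 + Real.cos θ₀ * h0 - d.2 * this
  · have hc : Continuous fun θ => Real.cos θ * d.2 - Real.sin θ * d.1 := by fun_prop
    obtain ⟨δ, hδ, h⟩ := Metric.eventually_nhds_iff.1 (hc.continuousAt.eventually_ne h0)
    exact ⟨δ, hδ, fun θ _ hlt => h (by rwa [Real.dist_eq])⟩

theorem LocallyRadial.mono {F G : Set Plane} {c : Plane} {r s : ℝ} (h : LocallyRadial F c r)
    (hG : G ⊆ F) (hs : s ≤ r) : LocallyRadial G c s := by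
  intro θ₀
  obtain ⟨δ, hδ, H⟩ := h θ₀
  exact ⟨δ, hδ, fun θ h1 h2 t ht hm => H θ h1 h2 t ⟨ht.1, ht.2.trans_le hs⟩ (hG hm)⟩

theorem LocallyRadial.union {F G : Set Plane} {c : Plane} {r : ℝ} (hF : LocallyRadial F c r)
    (hG : LocallyRadial G c r) : LocallyRadial (F ∪ G) c r := by
  intro θ₀
  obtain ⟨δ, hδ, H⟩ := hF θ₀
  obtain ⟨δ', hδ', H'⟩ := hG θ₀
  refine ⟨min δ δ', lt_min hδ hδ', fun θ h1 h2 t ht hm => ?_⟩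
  rcases hm with hm | hm
  · exact H θ h1 (h2.trans_le (min_le_left _ _)) t ht hm
  · exact H' θ h1 (h2.trans_le (min_le_right _ _)) t ht hm

theorem exists_locallyRadial_segment (a b c : Plane) :
    ∃ r > 0, LocallyRadial (segment ℝ a b) c r := by
  by_cases hc : c ∈ segment ℝ a b
  · refine ⟨1, one_pos, fun θ₀ => ?_⟩
    obtain ⟨x, _, hx⟩ := (segment_eq_image' ℝ a b ▸ hc : c ∈ _)
    by_cases hd : b - a = 0
    · refine ⟨1, one_pos, fun θ _ _ t ht hm => ?_⟩
      obtain ⟨y, _, hy⟩ := (segment_eq_image' ℝ a b ▸ hm : _ ∈ _)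
      simp only [hd, smul_zero, add_zero] at hx hy
      rw [← hx] at hy
      have e1 := congrArg Prod.fst hy
      have e2 := congrArg Prod.snd hy
      simp only [polarPt, left_eq_add, mul_eq_zero, ht.1.ne', false_or] at e1 e2
      have := Real.sin_sq_add_cos_sq θ
      simp [e1, e2] at this
    · obtain ⟨δ, hδ, H⟩ := exists_direction_ne hd θ₀
      refine ⟨δ, hδ, fun θ h1 h2 t ht hm => H θ h1 h2 ?_⟩
      obtain ⟨y, _, hy⟩ := (segment_eq_image' ℝ a b ▸ hm : _ ∈ _)
      rw [← hx] at hy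
      have e1 := congrArg Prod.fst hy
      have e2 := congrArg Prod.snd hy
      simp only [polarPt, Prod.fst_add, Prod.snd_add, Prod.smul_fst, Prod.smul_snd,
        smul_eq_mul] at e1 e2
      apply mul_left_cancel₀ ht.1.ne'
      linear_combination (b - a).1 * e2 - (b - a).2 * e1
  · have ho : IsOpen (segment ℝ a b)ᶜ := by
      have : IsClosed (segment ℝ a b) := by
        rw [segment_eq_image']
        exact (isCompact_Icc.image (by fun_prop)).isClosed
      exact this.isOpen_compl
    obtain ⟨r, hr, H⟩ := Metric.isOpen_iff.1 ho c hc
    exact ⟨r, hr, fun θ₀ => ⟨1, one_pos, fun θ _ _ t ht =>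
      H (Metric.mem_ball.2 ((dist_polarPt_le c ht.1.le θ).trans_lt ht.2))⟩⟩

theorem exists_locallyRadial_iUnion {n : ℕ} (F : Fin n → Set Plane) (c : Plane)
    (h : ∀ i, ∃ r > 0, LocallyRadial (F i) c r) : ∃ r > 0, LocallyRadial (⋃ i, F i) c r := by
  induction n with
  | zero => exact ⟨1, one_pos, fun _ => ⟨1, one_pos, by simp⟩⟩
  | succ n ih =>
    obtain ⟨r, hr, H⟩ := ih (fun i => F i.succ) fun i => h _
    obtain ⟨s, hs, H'⟩ := h 0
    refine ⟨min s r, lt_min hs hr, ((H'.mono subset_rfl (min_le_left _ _)).union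
      (H.mono subset_rfl (min_le_right _ _))).mono ?_ le_rfl⟩
    intro x hx
    obtain ⟨i, hi⟩ := mem_iUnion.1 hx
    induction i using Fin.cases with
    | zero => exact Or.inl hi
    | succ i => exact Or.inr (mem_iUnion.2 ⟨i, hi⟩)

theorem HasPolygonalFrontier.exists_locallyRadial {P : Set Plane} (h : HasPolygonalFrontier P)
    (c : Plane) : ∃ r > 0, LocallyRadial (frontier P) c r := by
  obtain ⟨n, s, hs⟩ := h
  obtain ⟨r, hr, H⟩ := exists_locallyRadial_iUnion (fun i => segment ℝ (s i).1 (s i).2) c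
    fun i => exists_locallyRadial_segment _ _ _
  exact ⟨r, hr, H.mono hs le_rfl⟩

/-- An open sector avoiding `frontier P` and meeting `P` is contained in `P`. -/
theorem polarPt_mem_of_frontier {P : Set Plane} {c : Plane} {r a b : ℝ}
    (hF : ∀ θ ∈ Ioo a b, ∀ t ∈ Ioo 0 r, polarPt c t θ ∉ frontier P)
    (hne : ∃ θ ∈ Ioo a b, ∃ t ∈ Ioo 0 r, polarPt c t θ ∈ P) :
    ∀ θ ∈ Ioo a b, ∀ t ∈ Ioo 0 r, polarPt c t θ ∈ P := by
  intro θ hθ t ht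
  by_contra hcon
  obtain ⟨θ', hθ', t', ht', hm⟩ := hne
  have hsub : (fun q : ℝ × ℝ => polarPt c q.1 q.2) '' (Ioo 0 r ×ˢ Ioo a b) ⊆
      interior P ∪ (closure P)ᶜ := by
    rintro _ ⟨q, ⟨hq1, hq2⟩, rfl⟩
    by_contra hq
    rw [mem_union, not_or, notMem_compl_iff] at hq
    exact hF _ hq2 _ hq1 ⟨hq.2, hq.1⟩
  obtain ⟨x, -, hx1, hx2⟩ := polarPt_isPreconnected c a b r _ _ isOpen_interior
    isClosed_closure.isOpen_compl hsub
    ⟨_, ⟨(t', θ'), ⟨ht', hθ'⟩, rfl⟩, (hsub ⟨(t', θ'), ⟨ht', hθ'⟩, rfl⟩).resolve_right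
      fun h => h (subset_closure hm)⟩
    ⟨_, ⟨(t, θ), ⟨ht, hθ⟩, rfl⟩, (hsub ⟨(t, θ), ⟨ht, hθ⟩, rfl⟩).resolve_left
      fun h => hcon (interior_subset h)⟩
  exact hx2 (subset_closure (interior_subset hx1))

theorem IsOpen.exists_polarPt_mem {P : Set Plane} (hP : IsOpen P) {c : Plane} {t θ : ℝ}
    (h : polarPt c t θ ∈ P) :
    ∃ ε > 0, ∀ t' θ', |t' - t| < ε → |θ' - θ| < ε → polarPt c t' θ' ∈ P := by
  obtain ⟨ε, hε, H⟩ := Metric.isOpen_iff.1 (hP.preimage (continuous_polarPt c)) (t, θ) h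
  refine ⟨ε, hε, fun t' θ' h1 h2 => ?_⟩
  have hm : (t', θ') ∈ Metric.ball (t, θ) ε := by
    rw [Metric.mem_ball, Prod.dist_eq, Real.dist_eq, Real.dist_eq]
    exact max_lt h1 h2
  exact H hm

/-! ### Thin right triangles and coverings of sectors -/

/-- The open right triangle with a horizontal leg of length `L` from the origin and angle `α`
at the origin. -/
def openTri (α L : ℝ) : Set Plane :=
  {p | 0 < p.2 ∧ p.2 * Real.cos α < p.1 * Real.sin α ∧ p.1 < L}

/-- The closed version of `openTri`. -/
def closedTri (α L : ℝ) : Set Plane :=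
  {p | 0 ≤ p.2 ∧ p.2 * Real.cos α ≤ p.1 * Real.sin α ∧ p.1 ≤ L}

/-- Reflection in the horizontal axis. -/
def conjPlane : Plane ≃ₜ Plane where
  toFun p := (p.1, -p.2)
  invFun p := (p.1, -p.2)
  left_inv p := by simp
  right_inv p := by simp
  continuous_toFun := by fun_prop
  continuous_invFun := by fun_prop

theorem conjPlane_apply (p : Plane) : conjPlane p = (p.1, -p.2) := rfl

theorem conjPlane_conjPlane (p : Plane) : conjPlane (conjPlane p) = p := by simp [conjPlane_apply]

theorem conjPlane_rigid_conjPlane (θ : ℝ) (v p : Plane) :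
    conjPlane (rigid θ v (conjPlane p)) = rigid (-θ) (conjPlane v) p := by
  simp only [conjPlane_apply, rigid, Real.cos_neg, Real.sin_neg]
  ext <;> ring

theorem conjPlane_polarPt (c : Plane) (t θ : ℝ) : conjPlane (polarPt c t θ) = polarPt (conjPlane c) t (-θ) := by
  simp only [conjPlane_apply, polarPt, Real.cos_neg, Real.sin_neg]
  ext <;> ring

/-- `T` is congruent, possibly with reversed orientation, to `openTri α L`. -/
def IsThinTri (α L : ℝ) (T : Set Plane) : Prop :=
  ∃ θ v, T = rigid θ v '' openTri α L ∨ T = rigid θ v '' (conjPlane '' openTri α L)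

/-- The closed sector with apex `c`, radius `r` and angles in `[φ, φ + α]`. -/
def sector (c : Plane) (φ α r : ℝ) : Set Plane :=
  {p | ∃ t ∈ Icc 0 r, ∃ θ ∈ Icc φ (φ + α), p = polarPt c t θ}

theorem closure_openTri {α L : ℝ} (hα : 0 < α) (hα' : α ≤ Real.pi / 3) (hL : 0 < L) :
    closure (openTri α L) = closedTri α L := by
  have hpi := Real.pi_pos
  have hs : 0 < Real.sin α := Real.sin_pos_of_pos_of_lt_pi hα (by linarith)
  have hc : 0 < Real.cos α := Real.cos_pos_of_mem_Ioo ⟨by linarith, by linarith⟩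
  apply Subset.antisymm
  · refine closure_minimal (fun p hp => ⟨hp.1.le, hp.2.1.le, hp.2.2.le⟩) ?_
    have c1 : IsClosed {p : Plane | 0 ≤ p.2} := isClosed_le (by fun_prop) (by fun_prop)
    have c2 : IsClosed {p : Plane | p.2 * Real.cos α ≤ p.1 * Real.sin α} :=
      isClosed_le (by fun_prop) (by fun_prop)
    have c3 : IsClosed {p : Plane | p.1 ≤ L} := isClosed_le (by fun_prop) (by fun_prop)
    exact c1.inter (c2.inter c3)
  · rintro p ⟨h1, h2, h3⟩
    set q : Plane := (L / 2, L * Real.sin α / (4 * Real.cos α))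
    have q1 : 0 < q.2 := by positivity
    have q2 : q.2 * Real.cos α < q.1 * Real.sin α := by
      simp only [q]
      field_simp
      norm_num
    have q3 : q.1 < L := by simp only [q]; linarith
    have hlim : Filter.Tendsto (fun s : ℝ => (1 - s) • p + s • q) (nhdsWithin 0 (Ioo 0 1))
        (nhds p) := by
      have : Continuous fun s : ℝ => (1 - s) • p + s • q := by fun_prop
      simpa using (this.tendsto 0).mono_left nhdsWithin_le_nhds
    have : (nhdsWithin (0 : ℝ) (Ioo 0 1)).NeBot := by
      rw [← mem_closure_iff_nhdsWithin_neBot, closure_Ioo (by norm_num)]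
      simp
    refine mem_closure_of_tendsto hlim (Filter.eventually_of_mem self_mem_nhdsWithin ?_)
    rintro s ⟨hs0, hs1⟩
    have hs1' : 0 ≤ 1 - s := by linarith
    simp only [openTri, mem_ofPred_eq, Prod.fst_add, Prod.snd_add, Prod.smul_fst, Prod.smul_snd,
      smul_eq_mul]
    refine ⟨by positivity, ?_, ?_⟩
    · nlinarith [mul_le_mul_of_nonneg_left h2 hs1', mul_lt_mul_of_pos_left q2 hs0]
    · nlinarith [mul_le_mul_of_nonneg_left h3 hs1', mul_lt_mul_of_pos_left q3 hs0]

theorem mem_sector_of_le {α r : ℝ} (hα : 0 < α) (hα' : α ≤ Real.pi / 3) {p : Plane}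
    (h1 : 0 ≤ p.2) (h2 : p.2 * Real.cos α ≤ p.1 * Real.sin α) (h3 : p.1 ≤ r / 2) :
    p ∈ sector 0 0 α r := by
  have hpi := Real.pi_pos
  obtain ⟨t, θ, ht, hθ, rfl, -⟩ := exists_polarPt 0 p
  simp only [polarPt, Prod.fst_zero, Prod.snd_zero, zero_add] at h1 h2 h3
  rcases ht.eq_or_lt with rfl | ht
  · exact ⟨0, ⟨le_rfl, by linarith⟩, 0, ⟨le_rfl, by linarith⟩, by simp [polarPt]⟩
  have hθ0 : 0 ≤ θ := by
    by_contra! h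
    nlinarith [Real.sin_neg_of_neg_of_neg_pi_lt h hθ.1]
  have hθα : θ ≤ α := by
    by_contra! h
    have := Real.sin_neg_of_neg_of_neg_pi_lt (x := α - θ) (by linarith) (by linarith [hθ.2])
    rw [Real.sin_sub] at this
    nlinarith
  have hcos : 1 / 2 ≤ Real.cos θ := by
    rw [← Real.cos_pi_div_three]
    exact Real.cos_le_cos_of_nonneg_of_le_pi hθ0 (by linarith) (by linarith)
  exact ⟨t, ⟨ht.le, by nlinarith⟩, θ, ⟨hθ0, by linarith⟩, rfl⟩

theorem le_of_mem_sector {α r : ℝ} (hα' : α ≤ Real.pi / 3) {p : Plane}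
    (h : p ∈ sector 0 0 α r) :
    0 ≤ p.2 ∧ p.2 * Real.cos α ≤ p.1 * Real.sin α ∧ 0 ≤ p.1 ∧ p.1 ≤ r := by
  have hpi := Real.pi_pos
  obtain ⟨t, ht, θ, hθ, rfl⟩ := h
  rw [zero_add] at hθ
  simp only [polarPt, Prod.fst_zero, Prod.snd_zero, zero_add]
  have h1 : 0 ≤ Real.sin θ := Real.sin_nonneg_of_nonneg_of_le_pi hθ.1 (by linarith [hθ.2])
  have h2 : 0 ≤ Real.cos θ := Real.cos_nonneg_of_mem_Icc ⟨by linarith [hθ.1], by linarith [hθ.2]⟩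
  have h3 : 0 ≤ Real.sin (α - θ) :=
    Real.sin_nonneg_of_nonneg_of_le_pi (by linarith [hθ.2]) (by linarith [hθ.1])
  rw [Real.sin_sub] at h3
  refine ⟨mul_nonneg ht.1 h1, ?_, mul_nonneg ht.1 h2, ?_⟩
  · nlinarith [mul_nonneg ht.1 h3]
  · nlinarith [Real.cos_le_one θ, ht.1, ht.2]

/-- Finitely many rigid copies of the closure of `T` lie in the sector of radius `r` and cover
the concentric sector of radius `r / 4`. -/
def CoversSector (T : Set Plane) (c : Plane) (φ α r : ℝ) : Prop :=
  ∃ G : Set (Plane → Plane), G.Finite ∧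
    (∀ g ∈ G, IsRigidMotion g ∧ closure (g '' T) ⊆ sector c φ α r) ∧
    sector c φ α (r / 4) ⊆ ⋃ g ∈ G, closure (g '' T)

theorem coversSector_openTri {α L r : ℝ} (hα : 0 < α) (hα' : α ≤ Real.pi / 3) (hL : 0 < L)
    (hr : 8 * L ≤ r) : CoversSector (openTri α L) 0 0 α r := by
  have hpi := Real.pi_pos
  have hs : 0 < Real.sin α := Real.sin_pos_of_pos_of_lt_pi hα (by linarith)
  have hc : 0 < Real.cos α := Real.cos_pos_of_mem_Ioo ⟨by linarith, by linarith⟩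
  set h := L * Real.sin α / Real.cos α
  have hh : 0 < h := by positivity
  have hhc : h * Real.cos α = L * Real.sin α := by simp only [h]; field_simp
  set N := ⌊r / 4 / L⌋₊
  set f₁ : ℕ → ℕ → Plane → Plane := fun i j => rigid 0 (i * L, j * h)
  set f₂ : ℕ → ℕ → Plane → Plane := fun i j => rigid Real.pi ((i + 1) * L, (j + 1) * h)
  have hfin := ((finite_Iic N).image2 f₁ (finite_Iic N)).union
    ((finite_Iic N).image2 f₂ (finite_Iic N))
  refine ⟨_, hfin.subset (sep_subset _ fun g => closure (g '' openTri α L) ⊆ sector 0 0 α r),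
    ?_, ?_⟩
  · rintro g ⟨⟨i, -, j, -, rfl⟩ | ⟨i, -, j, -, rfl⟩, hg⟩
    · exact ⟨isRigidMotion_rigid _ _, hg⟩
    · exact ⟨isRigidMotion_rigid _ _, hg⟩
  · intro p hp
    obtain ⟨h1, h2, h3, h4⟩ := le_of_mem_sector hα' hp
    set i := ⌊p.1 / L⌋₊
    set j := ⌊p.2 / h⌋₊
    have hiN : i ≤ N := Nat.floor_mono (div_le_div_of_nonneg_right h4 hL.le)
    have hji : j ≤ i := by
      refine Nat.floor_mono ?_
      rw [div_le_div_iff₀ hh hL]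
      refine le_of_mul_le_mul_right ?_ hc
      linear_combination L * h2 - p.1 * hhc
    have hi1 : i * L ≤ p.1 := (le_div_iff₀ hL).1 (Nat.floor_le (by positivity))
    have hi2 : p.1 < (i + 1) * L := (div_lt_iff₀ hL).1 (Nat.lt_floor_add_one _)
    have hj1 : j * h ≤ p.2 := (le_div_iff₀ hh).1 (Nat.floor_le (by positivity))
    have hj2 : p.2 < (j + 1) * h := (div_lt_iff₀ hh).1 (Nat.lt_floor_add_one _)
    have hjc : j * h * Real.cos α = j * L * Real.sin α := by linear_combination (j : ℝ) * hhc
    by_cases hcase : (p.2 - j * h) * Real.cos α ≤ (p.1 - i * L) * Real.sin α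
    · refine mem_biUnion (x := f₁ i j) ⟨Or.inl (mem_image2_of_mem hiN (hji.trans hiN)), ?_⟩ ?_
      · rw [closure_image_rigid, closure_openTri hα hα' hL]
        rintro _ ⟨q, ⟨q1, q2, q3⟩, rfl⟩
        have hij : (j : ℝ) ≤ i := by exact_mod_cast hji
        have := mul_le_mul_of_nonneg_right hij (mul_pos hL hs).le
        apply mem_sector_of_le hα hα' <;> simp only [rigid, Real.cos_zero, Real.sin_zero]
        · nlinarith [mul_nonneg (Nat.cast_nonneg (α := ℝ) j) hh.le]
        · nlinarith
        · nlinarith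
      · rw [closure_image_rigid, closure_openTri hα hα' hL]
        refine ⟨(p.1 - i * L, p.2 - j * h), ⟨by simpa using hj1, hcase, ?_⟩, ?_⟩
        · simp only; linarith
        · simp [rigid]
    · have hlt : j < i := by
        refine hji.lt_of_ne fun e => hcase ?_
        rw [← e]
        nlinarith
      refine mem_biUnion (x := f₂ i j) ⟨Or.inr (mem_image2_of_mem hiN (hji.trans hiN)), ?_⟩ ?_
      · rw [closure_image_rigid, closure_openTri hα hα' hL]
        rintro _ ⟨q, ⟨q1, q2, q3⟩, rfl⟩
        have hij : (j : ℝ) + 1 ≤ i := by exact_mod_cast hlt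
        have := mul_le_mul_of_nonneg_right hij (mul_pos hL hs).le
        have hqs := mul_le_mul_of_nonneg_right q3 hs.le
        have hq0 : 0 ≤ q.1 := by
          refine nonneg_of_mul_nonneg_left ?_ hs
          nlinarith
        have hqh : q.2 ≤ h := le_of_mul_le_mul_right (by linarith) hc
        apply mem_sector_of_le hα hα' <;> simp only [rigid, Real.cos_pi, Real.sin_pi]
        · nlinarith [mul_nonneg (Nat.cast_nonneg (α := ℝ) j) hh.le]
        · nlinarith
        · nlinarith
      · rw [closure_image_rigid, closure_openTri hα hα' hL]
        refine ⟨((i + 1) * L - p.1, (j + 1) * h - p.2), ⟨by simpa using hj2.le, ?_, ?_⟩, ?_⟩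
        · simp only; nlinarith
        · simp only; linarith
        · simp [rigid]

theorem CoversSector.of_homeomorph {T U : Set Plane} {c d : Plane} {φ ψ α r : ℝ}
    (H : CoversSector T c φ α r) (Φ : Plane ≃ₜ Plane)
    (hΦ : ∀ s, Φ '' sector c φ α s = sector d ψ α s)
    (hg : ∀ g, IsRigidMotion g → ∃ g', IsRigidMotion g' ∧ g' '' U = Φ '' (g '' T)) :
    CoversSector U d ψ α r := by
  obtain ⟨G, hG, hsub, hcov⟩ := H
  choose! F hF hFU using hg
  have key : ∀ g ∈ G, closure (F g '' U) = Φ '' closure (g '' T) := fun g hgG => by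
    rw [hFU g (hsub g hgG).1, Φ.image_closure]
  refine ⟨F '' G, hG.image _, ?_, ?_⟩
  · rintro _ ⟨g, hgG, rfl⟩
    refine ⟨hF g (hsub g hgG).1, ?_⟩
    rw [key g hgG, ← hΦ]
    exact image_mono (hsub g hgG).2
  · rw [← hΦ]
    rintro _ ⟨p, hp, rfl⟩
    obtain ⟨g, hgG, hpg⟩ := mem_iUnion₂.1 (hcov hp)
    refine mem_biUnion (mem_image_of_mem F hgG) ?_
    rw [key g hgG]
    exact mem_image_of_mem _ hpg

theorem image_rigid_sector (θ φ α s : ℝ) (v c : Plane) :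
    rigid θ v '' sector c φ α s = sector (rigid θ v c) (θ + φ) α s := by
  ext p
  constructor
  · rintro ⟨_, ⟨t, ht, ψ, hψ, rfl⟩, rfl⟩
    exact ⟨t, ht, θ + ψ, ⟨by linarith [hψ.1], by linarith [hψ.2]⟩, rigid_polarPt _ _ _ _ _⟩
  · rintro ⟨t, ht, ψ, hψ, rfl⟩
    refine ⟨_, ⟨t, ht, ψ - θ, ⟨by linarith [hψ.1], by linarith [hψ.2]⟩, rfl⟩, ?_⟩
    rw [rigid_polarPt]
    congr 1
    ring

theorem image_conjPlane_sector (φ α s : ℝ) (c : Plane) :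
    conjPlane '' sector c φ α s = sector (conjPlane c) (-φ - α) α s := by
  ext p
  constructor
  · rintro ⟨_, ⟨t, ht, ψ, hψ, rfl⟩, rfl⟩
    exact ⟨t, ht, -ψ, ⟨by linarith [hψ.2], by linarith [hψ.1]⟩, conjPlane_polarPt _ _ _⟩
  · rintro ⟨t, ht, ψ, hψ, rfl⟩
    refine ⟨_, ⟨t, ht, -ψ, ⟨by linarith [hψ.2], by linarith [hψ.1]⟩, rfl⟩, ?_⟩
    rw [conjPlane_polarPt, neg_neg]

theorem CoversSector.rigid_image {T : Set Plane} {c : Plane} {φ α r : ℝ}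
    (H : CoversSector T c φ α r) (θ : ℝ) (v : Plane) : CoversSector (rigid θ v '' T) c φ α r := by
  refine H.of_homeomorph (Homeomorph.refl _) (by simp) fun g hg =>
    ⟨g ∘ (rigidHomeo θ v).symm, hg.comp (isRigidMotion_rigid _ _), ?_⟩
  have : (rigidHomeo θ v).symm '' (rigid θ v '' T) = T := (rigidHomeo θ v).toEquiv.symm_image_image T
  rw [image_comp, this]
  simp

theorem CoversSector.rigid_sector {T : Set Plane} {c : Plane} {φ α r : ℝ}
    (H : CoversSector T c φ α r) (θ : ℝ) (v : Plane) :
    CoversSector T (rigid θ v c) (θ + φ) α r :=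
  H.of_homeomorph (rigidHomeo θ v) (fun _ => image_rigid_sector _ _ _ _ _ _) fun g hg =>
    ⟨rigid θ v ∘ g, (isRigidMotion_rigid θ v).comp hg, image_comp _ _ _⟩

theorem CoversSector.conjPlane_image {T : Set Plane} {c : Plane} {φ α r : ℝ}
    (H : CoversSector T c φ α r) : CoversSector (conjPlane '' T) (conjPlane c) (-φ - α) α r := by
  refine H.of_homeomorph conjPlane (fun _ => image_conjPlane_sector _ _ _ _) fun g hg => ?_
  obtain ⟨θ, v, rfl⟩ := hg.exists_eq_rigid
  refine ⟨rigid (-θ) (conjPlane v), isRigidMotion_rigid _ _, ?_⟩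
  rw [image_image, image_image]
  simp only [← conjPlane_rigid_conjPlane, conjPlane_conjPlane]

theorem IsThinTri.coversSector {α L r : ℝ} {T : Set Plane} (hT : IsThinTri α L T) (hα : 0 < α)
    (hα' : α ≤ Real.pi / 3) (hL : 0 < L) (hr : 8 * L ≤ r) (c : Plane) (φ : ℝ) :
    CoversSector T c φ α r := by
  have H := coversSector_openTri hα hα' hL hr
  obtain ⟨θ, v, rfl | rfl⟩ := hT
  · have := (H.rigid_sector φ c).rigid_image θ v
    simpa [rigid] using this
  · have := (H.conjPlane_image.rigid_sector (φ + α) c).rigid_image θ v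
    simpa [rigid, conjPlane_apply] using this

/-! ### Covering the exterior of a polygonal set by thin triangles -/

theorem disjoint_sector_of_exterior {P : Set Plane} (hP : IsOpen P) {c : Plane} {r a b φ α : ℝ}
    (hr : 0 < r) (hab : a < b) (ha : a ≤ φ) (hb : φ + α ≤ b)
    (H : ∀ θ ∈ Ioo a b, ∀ t ∈ Ioo 0 r, polarPt c t θ ∈ (closure P)ᶜ) :
    Disjoint (sector c φ α r) P := by
  rw [Set.disjoint_left]
  rintro _ ⟨t, ht, θ, hθ, rfl⟩ hm
  obtain ⟨ε, hε, h⟩ := hP.exists_polarPt_mem hm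
  rw [← closure_Ioo hr.ne] at ht
  have hθ' : θ ∈ closure (Ioo a b) := by
    rw [closure_Ioo hab.ne]
    exact ⟨ha.trans hθ.1, hθ.2.trans hb⟩
  obtain ⟨t', ht', htd⟩ := Metric.mem_closure_iff.1 ht ε hε
  obtain ⟨θ', hθ', hθd⟩ := Metric.mem_closure_iff.1 hθ' ε hε
  rw [dist_comm, Real.dist_eq] at htd hθd
  exact H θ' hθ' t' ht' (subset_closure (h t' θ' htd hθd))

theorem exists_finite_tiling {a b α : ℝ} (hα : 0 < α) (hab : α ≤ b - a) :
    ∃ Φ : Set ℝ, Φ.Finite ∧ (∀ φ ∈ Φ, a ≤ φ ∧ φ + α ≤ b) ∧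
      ∀ θ ∈ Icc a b, ∃ φ ∈ Φ, θ ∈ Icc φ (φ + α) := by
  refine ⟨insert (b - α) ({φ ∈ (fun k : ℕ => a + k * α) '' Iic ⌊(b - a) / α⌋₊ | φ + α ≤ b}),
    (((finite_Iic _).image _).subset (sep_subset _ _)).insert _, ?_, fun θ hθ => ?_⟩
  · rintro φ (rfl | ⟨⟨k, -, rfl⟩, h⟩)
    · constructor <;> linarith
    · exact ⟨by have := mul_nonneg (Nat.cast_nonneg (α := ℝ) k) hα.le; simpa using this, h⟩
  · by_cases hb : b - α ≤ θ
    · exact ⟨b - α, mem_insert _ _, hb, by linarith [hθ.2]⟩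
    have h0 : 0 ≤ θ - a := by linarith [hθ.1]
    have h1 := (le_div_iff₀ hα).1 (Nat.floor_le (div_nonneg h0 hα.le))
    have h2 := (div_lt_iff₀ hα).1 (Nat.lt_floor_add_one ((θ - a) / α))
    refine ⟨a + ⌊(θ - a) / α⌋₊ * α, mem_insert_of_mem _ ⟨⟨_, ?_, rfl⟩, ?_⟩, ?_, ?_⟩
    · exact Nat.floor_mono (by gcongr; exact hθ.2)
    · linarith
    · linarith
    · linarith

theorem exists_finite_angles_of_frontier {P : Set Plane} (hP : IsOpen P) {c : Plane}
    {r a b α : ℝ} (hr : 0 < r) (hα : 0 < α) (hab : α ≤ b - a)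
    (hF : ∀ θ ∈ Ioo a b, ∀ t ∈ Ioo 0 r, polarPt c t θ ∉ frontier P) :
    ∃ Φ : Set ℝ, Φ.Finite ∧ (∀ φ ∈ Φ, Disjoint (sector c φ α r) P) ∧
      ((∃ θ ∈ Ioo a b, ∃ t ∈ Ioo 0 r, polarPt c t θ ∈ (closure P)ᶜ) →
        ∀ θ ∈ Icc a b, ∃ φ ∈ Φ, θ ∈ Icc φ (φ + α)) := by
  by_cases hne : ∃ θ ∈ Ioo a b, ∃ t ∈ Ioo 0 r, polarPt c t θ ∈ (closure P)ᶜ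
  · obtain ⟨Φ, hΦ, h1, h2⟩ := exists_finite_tiling hα hab
    refine ⟨Φ, hΦ, fun φ hφ => ?_, fun _ => h2⟩
    refine disjoint_sector_of_exterior hP hr (by linarith) (h1 φ hφ).1 (h1 φ hφ).2 ?_
    refine polarPt_mem_of_frontier (fun θ hθ t ht hm => hF θ hθ t ht ?_) hne
    rw [frontier_compl] at hm
    exact frontier_closure_subset hm
  · exact ⟨∅, finite_empty, by simp, fun h => absurd h hne⟩

theorem exists_finite_angles {P : Set Plane} (hP : IsOpen P) {c : Plane} {r : ℝ} (hr : 0 < r)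
    (hF : LocallyRadial (frontier P) c r) :
    ∃ α₀ > 0, ∀ α, 0 < α → α ≤ α₀ →
      ∃ Φ : Set ℝ, Φ.Finite ∧ (∀ φ ∈ Φ, Disjoint (sector c φ α r) P) ∧
        ∀ θ ∈ Icc (-Real.pi) Real.pi, ∀ t ∈ Ico 0 r, polarPt c t θ ∈ (closure P)ᶜ →
          ∃ φ ∈ Φ, θ ∈ Icc φ (φ + α) := by
  refine isCompact_Icc.induction_on (p := fun A : Set ℝ => ∃ α₀ > 0, ∀ α, 0 < α → α ≤ α₀ →
      ∃ Φ : Set ℝ, Φ.Finite ∧ (∀ φ ∈ Φ, Disjoint (sector c φ α r) P) ∧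
        ∀ θ ∈ A, ∀ t ∈ Ico 0 r, polarPt c t θ ∈ (closure P)ᶜ →
          ∃ φ ∈ Φ, θ ∈ Icc φ (φ + α)) ?_ ?_ ?_ ?_
  · exact ⟨1, one_pos, fun α _ _ => ⟨∅, finite_empty, by simp, by simp⟩⟩
  · rintro A B hAB ⟨α₀, h0, H⟩
    refine ⟨α₀, h0, fun α hα hα' => ?_⟩
    obtain ⟨Φ, hΦ, h1, h2⟩ := H α hα hα'
    exact ⟨Φ, hΦ, h1, fun θ hθ => h2 θ (hAB hθ)⟩
  · rintro A B ⟨α₀, h0, H⟩ ⟨α₁, h0', H'⟩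
    refine ⟨min α₀ α₁, lt_min h0 h0', fun α hα hα' => ?_⟩
    obtain ⟨Φ, hΦ, h1, h2⟩ := H α hα (hα'.trans (min_le_left _ _))
    obtain ⟨Ψ, hΨ, h1', h2'⟩ := H' α hα (hα'.trans (min_le_right _ _))
    refine ⟨Φ ∪ Ψ, hΦ.union hΨ, fun φ hφ => hφ.elim (h1 φ) (h1' φ), ?_⟩
    rintro θ (hθ | hθ) t ht hm
    · obtain ⟨φ, hφ, h⟩ := h2 θ hθ t ht hm
      exact ⟨φ, Or.inl hφ, h⟩
    · obtain ⟨φ, hφ, h⟩ := h2' θ hθ t ht hm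
      exact ⟨φ, Or.inr hφ, h⟩
  · intro θ₀ _
    obtain ⟨δ, hδ, hF⟩ := hF θ₀
    refine ⟨Ioo (θ₀ - δ) (θ₀ + δ), mem_nhdsWithin_of_mem_nhds
      (Ioo_mem_nhds (by linarith) (by linarith)), δ, hδ, fun α hα hα' => ?_⟩
    obtain ⟨Φ, hΦ, h1, h2⟩ := exists_finite_angles_of_frontier (a := θ₀ - δ) (b := θ₀) hP hr hα
      (by linarith) fun θ hθ => hF θ hθ.2.ne (abs_lt.2 ⟨by linarith [hθ.1], by linarith [hθ.2]⟩)
    obtain ⟨Ψ, hΨ, h1', h2'⟩ := exists_finite_angles_of_frontier (a := θ₀) (b := θ₀ + δ) hP hr hα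
      (by linarith) fun θ hθ => hF θ hθ.1.ne' (abs_lt.2 ⟨by linarith [hθ.1], by linarith [hθ.2]⟩)
    refine ⟨Φ ∪ Ψ, hΦ.union hΨ, fun φ hφ => hφ.elim (h1 φ) (h1' φ), ?_⟩
    intro θ hθ t ht hm
    obtain ⟨ε, hε, hE⟩ := isClosed_closure.isOpen_compl.exists_polarPt_mem hm
    obtain ⟨t', ht', htt⟩ : ∃ t' ∈ Ioo 0 r, |t' - t| < ε := by
      have : t ∈ closure (Ioo 0 r) := by
        rw [closure_Ioo hr.ne]
        exact ⟨ht.1, ht.2.le⟩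
      obtain ⟨t', ht', h⟩ := Metric.mem_closure_iff.1 this ε hε
      exact ⟨t', ht', by rwa [dist_comm, Real.dist_eq] at h⟩
    rcases le_or_gt θ θ₀ with hle | hgt
    · obtain ⟨θ', hθ1, hθ2⟩ := exists_between (max_lt hθ.1 (sub_lt_self θ hε))
      obtain ⟨φ, hφ, h⟩ := h2 ⟨θ', ⟨(le_max_left _ _).trans_lt hθ1, hθ2.trans_le hle⟩, t', ht',
        hE _ _ htt (abs_lt.2 ⟨by linarith [(le_max_right (θ₀ - δ) (θ - ε)).trans_lt hθ1],
          by linarith⟩)⟩ θ ⟨hθ.1.le, hle⟩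
      exact ⟨φ, Or.inl hφ, h⟩
    · obtain ⟨φ, hφ, h⟩ := h2' ⟨θ, ⟨hgt, hθ.2⟩, t', ht', hE _ _ htt (by simpa)⟩ θ
        ⟨hgt.le, hθ.2.le⟩
      exact ⟨φ, Or.inr hφ, h⟩

/-- The exterior of `P` within `s` is covered by finitely many closed copies, disjoint from `P`,
of any sufficiently small and thin triangle. -/
def ExteriorCoverable (P s : Set Plane) : Prop :=
  ∃ α₀ > 0, ∃ L₀ > 0, ∀ α L T, 0 < α → α ≤ α₀ → 0 < L → L ≤ L₀ → IsThinTri α L T →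
    ∃ G : Set (Plane → Plane), G.Finite ∧
      (∀ g ∈ G, IsRigidMotion g ∧ Disjoint (closure (g '' T)) P) ∧
      s ∩ (closure P)ᶜ ⊆ ⋃ g ∈ G, closure (g '' T)

theorem exteriorCoverable_ball {P : Set Plane} (hP : IsOpen P) {c : Plane} {r : ℝ} (hr : 0 < r)
    (hF : LocallyRadial (frontier P) c r) : ExteriorCoverable P (Metric.ball c (r / 8)) := by
  obtain ⟨α₀, h0, H⟩ := exists_finite_angles hP hr hF
  refine ⟨min α₀ (Real.pi / 3), lt_min h0 (by positivity), r / 8, by positivity,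
    fun α L T hα hα' hL hL' hT => ?_⟩
  obtain ⟨Φ, hΦ, h1, h2⟩ := H α hα (hα'.trans (min_le_left _ _))
  choose G hG hG1 hG2 using fun φ =>
    hT.coversSector hα (hα'.trans (min_le_right _ _)) hL (by linarith) c φ (r := r)
  refine ⟨⋃ φ ∈ Φ, G φ, hΦ.biUnion fun φ _ => hG φ, fun g hg => ?_, ?_⟩
  · obtain ⟨φ, hφ, hgφ⟩ := mem_iUnion₂.1 hg
    exact ⟨(hG1 φ g hgφ).1, (h1 φ hφ).mono_left (hG1 φ g hgφ).2⟩
  · rintro p ⟨hpc, hpE⟩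
    obtain ⟨t, θ, ht, hθ, rfl, hle⟩ := exists_polarPt c p
    rw [Metric.mem_ball, Prod.dist_eq, max_lt_iff, Real.dist_eq, Real.dist_eq] at hpc
    obtain ⟨φ, hφ, hθφ⟩ := h2 θ ⟨hθ.1.le, hθ.2⟩ t ⟨ht, by linarith⟩ hpE
    obtain ⟨g, hg, hgm⟩ := mem_iUnion₂.1
      (hG2 φ ⟨t, ⟨ht, by linarith⟩, θ, hθφ, rfl⟩)
    exact mem_biUnion (mem_iUnion₂.2 ⟨φ, hφ, hg⟩) hgm

theorem HasPolygonalFrontier.exteriorCoverable {P : Set Plane} (hP : IsOpen P)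
    (hF : HasPolygonalFrontier P) {K : Set Plane} (hK : IsCompact K) : ExteriorCoverable P K := by
  refine hK.induction_on ?_ ?_ ?_ ?_
  · exact ⟨1, one_pos, 1, one_pos, fun _ _ _ _ _ _ _ _ => ⟨∅, finite_empty, by simp, by simp⟩⟩
  · rintro A B hAB ⟨α₀, h0, L₀, h1, H⟩
    refine ⟨α₀, h0, L₀, h1, fun α L T a1 a2 a3 a4 a5 => ?_⟩
    obtain ⟨G, hG, hG1, hG2⟩ := H α L T a1 a2 a3 a4 a5
    exact ⟨G, hG, hG1, (inter_subset_inter_left _ hAB).trans hG2⟩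
  · rintro A B ⟨α₀, h0, L₀, h1, H⟩ ⟨α₀', h0', L₀', h1', H'⟩
    refine ⟨min α₀ α₀', lt_min h0 h0', min L₀ L₀', lt_min h1 h1', fun α L T a1 a2 a3 a4 a5 => ?_⟩
    obtain ⟨G, hG, hG1, hG2⟩ := H α L T a1 (a2.trans (min_le_left _ _)) a3
      (a4.trans (min_le_left _ _)) a5
    obtain ⟨G', hG', hG1', hG2'⟩ := H' α L T a1 (a2.trans (min_le_right _ _)) a3
      (a4.trans (min_le_right _ _)) a5
    refine ⟨G ∪ G', hG.union hG', fun g hg => hg.elim (hG1 g) (hG1' g), ?_⟩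
    rw [union_inter_distrib_right, biUnion_union]
    exact union_subset_union hG2 hG2'
  · intro c _
    obtain ⟨r, hr, hc⟩ := hF.exists_locallyRadial c
    exact ⟨_, mem_nhdsWithin_of_mem_nhds (Metric.ball_mem_nhds c (by positivity)),
      exteriorCoverable_ball hP hr hc⟩

/-- A regular open polygonal subset of the unit square arises from the square by removing
finitely many closed copies of any sufficiently small and thin triangle. -/
theorem HasPolygonalFrontier.exists_unitSq_diff {P : Set Plane} (hF : HasPolygonalFrontier P)
    (hP : P = interior (closure P)) (hsub : P ⊆ UnitSq) :
    ∃ α₀ > 0, ∃ L₀ > 0, ∀ α L T, 0 < α → α ≤ α₀ → 0 < L → L ≤ L₀ → IsThinTri α L T →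
      ∃ G : Set (Plane → Plane), G.Finite ∧ (∀ g ∈ G, IsRigidMotion g) ∧
        UnitSq \ ⋃ g ∈ G, closure (g '' T) = P := by
  have hPo : IsOpen P := hP ▸ isOpen_interior
  obtain ⟨α₀, h0, L₀, h1, H⟩ := hF.exteriorCoverable hPo
    ((isCompact_Icc (a := (0 : ℝ)) (b := 1)).prod (isCompact_Icc (a := (0 : ℝ)) (b := 1)))
  refine ⟨α₀, h0, L₀, h1, fun α L T a1 a2 a3 a4 a5 => ?_⟩
  obtain ⟨G, hG, hG1, hG2⟩ := H α L T a1 a2 a3 a4 a5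
  refine ⟨G, hG, fun g hg => (hG1 g hg).1, Subset.antisymm ?_ ?_⟩
  · have ho : IsOpen (UnitSq \ ⋃ g ∈ G, closure (g '' T)) :=
      (isOpen_Ioo.prod isOpen_Ioo).sdiff (hG.isClosed_biUnion fun _ _ => isClosed_closure)
    rw [hP]
    refine interior_maximal (fun p hp => ?_) ho
    by_contra hpc
    exact hp.2 (hG2 ⟨⟨Ioo_subset_Icc_self hp.1.1, Ioo_subset_Icc_self hp.1.2⟩, hpc⟩)
  · intro p hp
    refine ⟨hsub hp, fun hm => ?_⟩
    obtain ⟨g, hg, hgm⟩ := mem_iUnion₂.1 hm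
    exact Set.disjoint_left.1 (hG1 g hg).2 hgm hp

/-! ### Cutting a thin triangle out of a polygonal set with a unit square -/

theorem exists_sector_of_left {P : Set Plane} (hP : IsOpen P) {v : Plane} {r : ℝ}
    (hF : LocallyRadial (frontier P) v r)
    (hne : ∃ θ ∈ Ioo (Real.pi / 2) Real.pi, ∃ t ∈ Ioo 0 r, polarPt v t θ ∈ P) :
    ∃ β η, Real.pi / 2 < β ∧ β ≤ Real.pi ∧ 0 < η ∧
      (∀ θ ∈ Ioo (β - η) β, ∀ t ∈ Ioo 0 r, polarPt v t θ ∈ P) ∧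
      ∀ θ ∈ Ico β Real.pi, ∀ t ∈ Ioo 0 r, polarPt v t θ ∉ P := by
  set B := {θ | θ ∈ Ioo (Real.pi / 2) Real.pi ∧ ∃ t ∈ Ioo 0 r, polarPt v t θ ∈ P}
  have hbdd : BddAbove B := ⟨Real.pi, fun θ hθ => hθ.1.2.le⟩
  obtain ⟨b, hb⟩ : B.Nonempty := by
    obtain ⟨θ, hθ, h⟩ := hne
    exact ⟨θ, hθ, h⟩
  have hlt : ∀ θ ∈ B, θ < sSup B := by
    rintro θ ⟨hθ, t, ht, hm⟩
    obtain ⟨ε, hε, H⟩ := hP.exists_polarPt_mem hm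
    obtain ⟨θ', h1, h2⟩ := exists_between (lt_min hθ.2 (lt_add_of_pos_right θ hε))
    refine h1.trans_le (le_csSup hbdd ⟨⟨hθ.1.trans h1, h2.trans_le (min_le_left _ _)⟩, t, ht,
      H _ _ (by simpa) (abs_lt.2 ⟨by linarith, ?_⟩)⟩)
    linarith [h2.trans_le (min_le_right _ _)]
  obtain ⟨η, hη, hF⟩ := hF (sSup B)
  refine ⟨sSup B, η, hb.1.1.trans (hlt b hb), csSup_le ⟨b, hb⟩ fun θ hθ => hθ.1.2.le, hη, ?_, ?_⟩
  · refine polarPt_mem_of_frontier (fun θ hθ => hF θ hθ.2.ne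
      (abs_lt.2 ⟨by linarith [hθ.1], by linarith [hθ.2]⟩)) ?_
    obtain ⟨θ, hθ, h⟩ := exists_lt_of_lt_csSup ⟨b, hb⟩ (sub_lt_self (sSup B) hη)
    exact ⟨θ, ⟨h, hlt θ hθ⟩, hθ.2⟩
  · intro θ hθ t ht hm
    exact absurd (hlt θ ⟨⟨(hb.1.1.trans (hlt b hb)).trans_le hθ.1, hθ.2⟩, t, ht, hm⟩)
      hθ.1.not_gt

theorem exists_unitSq_inter_of_left {P : Set Plane} (hP : IsOpen P) {v : Plane} {r : ℝ}
    (hr : 0 < r) (hv : ∀ p ∈ P, v.2 < p.2) (hF : LocallyRadial (frontier P) v r)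
    (hne : ∃ θ ∈ Ioo (Real.pi / 2) Real.pi, ∃ t ∈ Ioo 0 r, polarPt v t θ ∈ P)
    {α₀ L₀ : ℝ} (hα₀ : 0 < α₀) (hL₀ : 0 < L₀) :
    ∃ α L φ w, 0 < α ∧ α ≤ α₀ ∧ 0 < L ∧ L ≤ L₀ ∧
      P ∩ rigid φ w '' UnitSq = rigid φ v '' openTri α L := by
  have hpi := Real.pi_pos
  obtain ⟨β, η, hβ, hβ', hη, hin, hout⟩ := exists_sector_of_left hP hF hne
  obtain ⟨α, hα, hαm⟩ := exists_between (a₁ := (0 : ℝ))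
    (a₂ := min (min α₀ (Real.pi / 3)) (min η (β - Real.pi / 2)))
    (lt_min (lt_min hα₀ (by positivity)) (lt_min hη (by linarith)))
  simp only [lt_min_iff] at hαm
  obtain ⟨⟨hα1, hα2⟩, hα3, hα4⟩ := hαm
  set φ := β - α
  have hφ1 : Real.pi / 2 < φ := by simp only [φ]; linarith
  have hφ2 : φ < Real.pi := by simp only [φ]; linarith
  have hsφ : 0 < Real.sin φ := Real.sin_pos_of_pos_of_lt_pi (by linarith) hφ2
  have hcφ : 0 < -Real.cos φ := by
    have := Real.cos_neg_of_pi_div_two_lt_of_lt hφ1 (by linarith)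
    linarith
  have hsα : 0 < Real.sin α := Real.sin_pos_of_pos_of_lt_pi hα (by linarith)
  have hcα : 0 < Real.cos α := Real.cos_pos_of_mem_Ioo ⟨by linarith, by linarith⟩
  obtain ⟨L, hL, hLm⟩ := exists_between (a₁ := (0 : ℝ))
    (a₂ := min (min L₀ (1 / 2)) (min (r / 2) (r / 2 * -Real.cos φ)))
    (lt_min (lt_min hL₀ (by positivity)) (lt_min (by positivity) (by positivity)))
  simp only [lt_min_iff] at hLm
  obtain ⟨⟨hL1, hL2⟩, hL3, hL4⟩ := hLm
  refine ⟨α, L, φ, rigid φ v (L - 1, 0), hα, hα1.le, hL, hL1.le, ?_⟩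
  have hUimg : rigid φ (rigid φ v (L - 1, 0)) '' UnitSq =
      rigid φ v '' (Ioo (L - 1) L ×ˢ Ioo 0 1) := by
    ext p
    constructor
    · rintro ⟨q, ⟨hq1, hq2⟩, rfl⟩
      refine ⟨(q.1 + (L - 1), q.2), ⟨⟨by linarith [hq1.1], by linarith [hq1.2]⟩, hq2⟩, ?_⟩
      simp only [rigid]
      ext <;> simp only <;> ring
    · rintro ⟨q, ⟨hq1, hq2⟩, rfl⟩
      refine ⟨(q.1 - (L - 1), q.2), ⟨⟨by linarith [hq1.1], by linarith [hq1.2]⟩, hq2⟩, ?_⟩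
      simp only [rigid]
      ext <;> simp only <;> ring
  rw [hUimg]
  ext p
  constructor
  · rintro ⟨hp, q, ⟨⟨-, hq1⟩, hq2, -⟩, rfl⟩
    refine ⟨q, ⟨hq2, ?_, hq1⟩, rfl⟩
    have hy := hv _ hp
    have hyx : q.2 * -Real.cos φ < q.1 * Real.sin φ := by
      simp only [rigid] at hy
      linarith
    have hq0 : 0 < q.1 := pos_of_mul_pos_left ((mul_pos hq2 hcφ).trans hyx) hsφ.le
    have hq2' : q.2 < r / 2 := by
      refine lt_of_mul_lt_mul_right (hyx.trans_le ?_) hcφ.le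
      nlinarith [Real.sin_le_one φ]
    obtain ⟨t, θ, ht, hθ, rfl, hle⟩ := exists_polarPt 0 q
    simp only [Prod.fst_zero, Prod.snd_zero, sub_zero, abs_of_pos hq0, abs_of_pos hq2] at hle
    rw [rigid_polarPt_zero] at hp hy
    have htr : t < r := by linarith
    simp only [polarPt, Prod.fst_zero, Prod.snd_zero, zero_add, lt_add_iff_pos_right]
      at hq0 hq2 hy ⊢
    have ht0 : 0 < t := ht.lt_of_ne' fun h => by simp [h] at hq0
    have hθ0 : 0 < θ := by
      by_contra! h
      nlinarith [Real.sin_nonpos_of_nonpos_of_neg_pi_le h hθ.1.le]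
    have hθπ : φ + θ < Real.pi := by
      by_contra! h
      have := Real.sin_nonpos_of_nonpos_of_neg_pi_le (x := φ + θ - 2 * Real.pi)
        (by linarith [hθ.2]) (by linarith)
      rw [Real.sin_sub_two_pi] at this
      nlinarith
    have hθα : θ < α := by
      by_contra! h
      exact hout (φ + θ) ⟨by simp only [φ]; linarith, hθπ⟩ t ⟨ht0, htr⟩ hp
    have := Real.sin_pos_of_pos_of_lt_pi (x := α - θ) (by linarith) (by linarith)
    rw [Real.sin_sub] at this
    nlinarith
  · rintro ⟨q, ⟨h1, h2, h3⟩, rfl⟩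
    obtain ⟨t, θ, ht, hθ, rfl, -⟩ := exists_polarPt 0 q
    simp only [polarPt, Prod.fst_zero, Prod.snd_zero, zero_add] at h1 h2 h3
    have ht0 : 0 < t := ht.lt_of_ne' fun h => by simp [h] at h1
    have hθ0 : 0 < θ := by
      by_contra! h
      nlinarith [Real.sin_nonpos_of_nonpos_of_neg_pi_le h hθ.1.le]
    have hθα : θ < α := by
      by_contra! h
      have := Real.sin_nonpos_of_nonpos_of_neg_pi_le (x := α - θ) (by linarith)
        (by linarith [hθ.2])
      rw [Real.sin_sub] at this
      nlinarith
    have hcos : 1 / 2 ≤ Real.cos θ := by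
      rw [← Real.cos_pi_div_three]
      exact Real.cos_le_cos_of_nonneg_of_le_pi hθ0.le (by linarith) (by linarith)
    have htL : t < 2 * L := by nlinarith
    have hlo : 0 ≤ t * Real.cos θ := mul_nonneg ht (by linarith)
    have hhi : t * Real.sin θ ≤ t := mul_le_of_le_one_right ht (Real.sin_le_one θ)
    refine ⟨?_, polarPt 0 t θ, ?_, rfl⟩
    · rw [rigid_polarPt_zero]
      exact hin _ ⟨by simp only [φ]; linarith, by simp only [φ]; linarith⟩ t ⟨ht0, by linarith⟩
    · simp only [polarPt, Prod.fst_zero, Prod.snd_zero, zero_add]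
      exact ⟨⟨by linarith, h3⟩, h1, by linarith⟩

/-- Reflection in the vertical axis. -/
def negFst : Plane ≃ₜ Plane where
  toFun p := (-p.1, p.2)
  invFun p := (-p.1, p.2)
  left_inv p := by simp
  right_inv p := by simp
  continuous_toFun := by fun_prop
  continuous_invFun := by fun_prop

theorem negFst_apply (p : Plane) : negFst p = (-p.1, p.2) := rfl

theorem negFst_negFst (p : Plane) : negFst (negFst p) = p := by simp [negFst_apply]

theorem negFst_image_image (s : Set Plane) : negFst '' (negFst '' s) = s := by
  simp [image_image, negFst_negFst]

theorem negFst_polarPt (c : Plane) (t θ : ℝ) :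
    negFst (polarPt c t θ) = polarPt (negFst c) t (Real.pi - θ) := by
  simp only [negFst_apply, polarPt, Real.cos_pi_sub, Real.sin_pi_sub]
  ext <;> ring

theorem negFst_image_rigid_unitSq (θ : ℝ) (v : Plane) :
    ∃ w, negFst '' (rigid θ v '' UnitSq) = rigid (-θ) w '' UnitSq := by
  have key : ∀ p : Plane, negFst (rigid θ v p) =
      rigid (-θ) (-Real.cos θ - v.1, Real.sin θ + v.2) (1 - p.1, p.2) := by
    intro p
    simp only [negFst_apply, rigid, Real.cos_neg, Real.sin_neg]
    ext <;> ring
  refine ⟨(-Real.cos θ - v.1, Real.sin θ + v.2), ?_⟩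
  ext q
  constructor
  · rintro ⟨_, ⟨p, ⟨hp1, hp2⟩, rfl⟩, rfl⟩
    exact ⟨(1 - p.1, p.2), ⟨⟨by simpa using hp1.2, by simpa using hp1.1⟩, hp2⟩, (key p).symm⟩
  · rintro ⟨p, ⟨hp1, hp2⟩, rfl⟩
    refine ⟨_, ⟨(1 - p.1, p.2), ⟨⟨by simpa using hp1.2, by simpa using hp1.1⟩, hp2⟩, rfl⟩, ?_⟩
    rw [key]
    simp

theorem negFst_rigid (θ : ℝ) (v p : Plane) :
    negFst (rigid θ v p) = rigid (Real.pi - θ) (negFst v) (conjPlane p) := by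
  simp only [negFst_apply, conjPlane_apply, rigid, Real.cos_pi_sub, Real.sin_pi_sub]
  ext <;> ring

theorem LocallyRadial.negFst_image {F : Set Plane} {c : Plane} {r : ℝ}
    (h : LocallyRadial F c r) : LocallyRadial (negFst '' F) (negFst c) r := by
  intro θ₀
  obtain ⟨δ, hδ, H⟩ := h (Real.pi - θ₀)
  refine ⟨δ, hδ, fun θ h1 h2 t ht => ?_⟩
  rintro ⟨p, hp, hpe⟩
  refine H (Real.pi - θ) (fun h => h1 (by linarith)) ?_ t ht ?_
  · rw [← abs_neg]
    convert h2 using 2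
    ring
  · have := congrArg negFst hpe
    rw [negFst_negFst, negFst_polarPt, negFst_negFst] at this
    rwa [← this]

/-- A bounded open polygonal set meets some unit square in an arbitrarily small and thin right
triangle. -/
theorem HasPolygonalFrontier.exists_unitSq_inter {P : Set Plane} (hF : HasPolygonalFrontier P)
    (hP : IsOpen P) (hne : P.Nonempty) (hb : Bornology.IsBounded P)
    {α₀ L₀ : ℝ} (hα₀ : 0 < α₀) (hL₀ : 0 < L₀) :
    ∃ α L φ w, 0 < α ∧ α ≤ α₀ ∧ 0 < L ∧ L ≤ L₀ ∧ IsThinTri α L (P ∩ rigid φ w '' UnitSq) := by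
  have hpi := Real.pi_pos
  obtain ⟨v, hvP, hvmin⟩ := hb.isCompact_closure.exists_isMinOn hne.closure
    continuous_snd.continuousOn
  have hv : ∀ p ∈ P, v.2 < p.2 := by
    intro p hp
    obtain ⟨ε, hε, h⟩ := Metric.isOpen_iff.1 hP p hp
    have : (p.1, p.2 - ε / 2) ∈ P := h (by
      rw [Metric.mem_ball, Prod.dist_eq, Real.dist_eq, Real.dist_eq]
      simpa [abs_of_pos (half_pos hε)] using hε)
    have := hvmin (subset_closure this)
    simp only [mem_ofPred_eq] at this
    linarith
  obtain ⟨r, hr, hrad⟩ := hF.exists_locallyRadial v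
  obtain ⟨p, hp, hpv⟩ := Metric.mem_closure_iff.1 hvP (r / 2) (by positivity)
  obtain ⟨t, θ, ht, hθ, rfl, hle⟩ := exists_polarPt v p
  rw [dist_comm, Prod.dist_eq, max_lt_iff, Real.dist_eq, Real.dist_eq] at hpv
  have htr : t < r := by linarith
  have hvp := hv _ hp
  simp only [polarPt, lt_add_iff_pos_right] at hvp
  have ht0 : 0 < t := ht.lt_of_ne' fun h => by simp [h] at hvp
  have hθ0 : 0 < θ := by
    by_contra! h
    nlinarith [Real.sin_nonpos_of_nonpos_of_neg_pi_le h hθ.1.le]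
  have hθπ : θ < Real.pi := hθ.2.lt_of_ne fun h => by simp [h] at hvp
  by_cases hθ2 : Real.pi / 2 ≤ θ
  · obtain ⟨ε, hε, H⟩ := hP.exists_polarPt_mem hp
    obtain ⟨θ', h1, h2⟩ := exists_between (lt_min hθπ (lt_add_of_pos_right θ hε))
    rw [lt_min_iff] at h2
    obtain ⟨α, L, φ, w, a1, a2, a3, a4, h⟩ := exists_unitSq_inter_of_left hP hr hv hrad
      ⟨θ', ⟨hθ2.trans_lt h1, h2.1⟩, t, ⟨ht0, htr⟩,
        H _ _ (by simpa) (abs_lt.2 ⟨by linarith, by linarith⟩)⟩ hα₀ hL₀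
    exact ⟨α, L, φ, w, a1, a2, a3, a4, φ, v, Or.inl h⟩
  · have hrad' := hrad.negFst_image
    rw [negFst.image_frontier] at hrad'
    obtain ⟨α, L, φ, w, a1, a2, a3, a4, h⟩ := exists_unitSq_inter_of_left
      (negFst.isOpenMap P hP) hr (by rintro _ ⟨q, hq, rfl⟩; exact hv q hq) hrad'
      ⟨Real.pi - θ, ⟨by linarith, by linarith⟩, t, ⟨ht0, htr⟩, _, hp, negFst_polarPt _ _ _⟩
      hα₀ hL₀
    obtain ⟨w', hw'⟩ := negFst_image_rigid_unitSq φ w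
    refine ⟨α, L, -φ, w', a1, a2, a3, a4, Real.pi - φ, v, Or.inr ?_⟩
    have h' := congrArg (negFst '' ·) h
    simp only [image_inter negFst.injective, negFst_image_image, hw'] at h'
    rw [h', image_image, image_image]
    simp only [negFst_rigid, negFst_negFst]

/-! ### Reachable configurations -/

/-- Reachability with undo stacks of size one. -/
def Reach (c c' : UConfig) : Prop := ∃ s, DUReach 1 s c c'

theorem Reach.refl (c : UConfig) : Reach c c := ⟨0, .refl c⟩

theorem Reach.head {c c' c'' : UConfig} (h : DUStep 1 c c') (h' : Reach c' c'') : Reach c c'' :=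
  h'.elim fun s hs => ⟨s + 1, .step h hs⟩

theorem Reach.trans {c c' c'' : UConfig} (h : Reach c c') (h' : Reach c' c'') : Reach c c'' := by
  obtain ⟨s, hs⟩ := h
  induction hs with
  | refl => exact h'
  | step hstep _ ih => exact (ih h').head hstep

/-- Exchange of the two tools. -/
def UConfig.swap (c : UConfig) : UConfig := ⟨c.T₂, c.S₂, c.T₁, c.S₁⟩

theorem DUStep.swap {k : ℕ} {c c' : UConfig} (h : DUStep k c c') : DUStep k c.swap c'.swap := by
  cases h with
  | snip1 g hg => exact .snip2 g hg c.swap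
  | snip2 g hg => exact .snip1 g hg c.swap
  | reset1 => exact .reset2 c.swap
  | reset2 => exact .reset1 c.swap
  | undo1 => exact .undo2 _ _ _ _ _
  | undo2 => exact .undo1 _ _ _ _ _

theorem Reach.swap {c c' : UConfig} (h : Reach c c') : Reach c.swap c'.swap := by
  obtain ⟨s, hs⟩ := h
  induction hs with
  | refl => exact .refl _
  | step hstep _ ih => exact .head hstep.swap ih

theorem exists_reach_diff_biUnion {G : Set (Plane → Plane)} (hG : G.Finite)
    (hg : ∀ g ∈ G, IsRigidMotion g) (T₁ T₂ : Set Plane) (S₁ S₂ : List (Set Plane)) :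
    ∃ S₂', Reach ⟨T₁, S₁, T₂, S₂⟩ ⟨T₁, S₁, T₂ \ ⋃ g ∈ G, closure (g '' T₁), S₂'⟩ := by
  induction G, hG using Set.Finite.induction_on with
  | empty => exact ⟨S₂, by simpa using Reach.refl _⟩
  | @insert g G _ _ ih =>
    obtain ⟨S₂', h⟩ := ih fun g' hg' => hg g' (mem_insert_of_mem _ hg')
    rw [biUnion_insert, union_comm, ← sdiff_sdiff]
    exact ⟨_, h.trans (.head (.snip2 g (hg g (mem_insert _ _)) _) (.refl _))⟩

theorem interior_closure_rigid_unitSq (θ : ℝ) (v : Plane) :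
    interior (closure (rigid θ v '' UnitSq)) = rigid θ v '' UnitSq := by
  rw [← coe_rigidHomeo, ← Homeomorph.image_closure, ← Homeomorph.image_interior, UnitSq,
    closure_prod_eq, closure_Ioo zero_ne_one, interior_prod_eq, interior_Icc]

theorem diff_closure_unitSq_diff {P : Set Plane} (hP : P ⊆ UnitSq) (θ : ℝ) (v : Plane) :
    P \ closure (id '' (UnitSq \ closure (rigid θ v '' UnitSq))) = P ∩ rigid θ v '' UnitSq := by
  rw [image_id]
  ext x
  refine and_congr_right fun hx => ⟨fun h => ?_, fun h hcl => ?_⟩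
  · rw [← interior_closure_rigid_unitSq]
    refine interior_maximal (fun y hy => ?_) (isClosed_closure.isOpen_compl.inter isOpen_unitSq)
      ⟨h, hP hx⟩
    by_contra hcon
    exact hy.1 (subset_closure ⟨hy.2, hcon⟩)
  · obtain ⟨y, hyU, hy⟩ :=
      mem_closure_iff.1 hcl _ ((rigidHomeo θ v).isOpenMap _ isOpen_unitSq) h
    exact hy.2 (subset_closure hyU)

theorem hasPolygonalFrontier_unitSq : HasPolygonalFrontier UnitSq := by
  refine ⟨4, ![((0, 0), (0, 1)), ((1, 0), (1, 1)), ((0, 0), (1, 0)), ((0, 1), (1, 1))], ?_⟩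
  rw [UnitSq, frontier_prod_eq, frontier_Ioo zero_lt_one, closure_Ioo zero_ne_one]
  rintro ⟨x, y⟩ (⟨hx, hy | hy⟩ | ⟨hx | hx, hy⟩)
  · exact mem_iUnion.2 ⟨2, 1 - x, x, by linarith [hx.2], hx.1, by ring, by ext <;> simp_all⟩
  · exact mem_iUnion.2 ⟨3, 1 - x, x, by linarith [hx.2], hx.1, by ring, by ext <;> simp_all⟩
  · exact mem_iUnion.2 ⟨0, 1 - y, y, by linarith [hy.2], hy.1, by ring, by ext <;> simp_all⟩
  · exact mem_iUnion.2 ⟨1, 1 - y, y, by linarith [hy.2], hy.1, by ring, by ext <;> simp_all⟩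

theorem isBounded_unitSq : Bornology.IsBounded UnitSq :=
  (Metric.isBounded_Ioo 0 1).prod (Metric.isBounded_Ioo 0 1)

/-- While the first tool returns to its shape `P`, the second one can be turned into any
polygonal shape `Q`. -/
theorem exists_reach_second {P Q : Set Plane} (hP : IsOpen P) (hPne : P.Nonempty)
    (hPsub : P ⊆ UnitSq) (hPF : HasPolygonalFrontier P) (hQ : Q = interior (closure Q))
    (hQsub : Q ⊆ UnitSq) (hQF : HasPolygonalFrontier Q) (S₁ : List (Set Plane)) (T₂ : Set Plane)
    (S₂ : List (Set Plane)) : ∃ S₁' S₂', Reach ⟨P, S₁, T₂, S₂⟩ ⟨P, S₁', Q, S₂'⟩ := by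
  obtain ⟨α₀, hα₀, L₀, hL₀, H⟩ := hQF.exists_unitSq_diff hQ hQsub
  obtain ⟨α, L, φ, w, a1, a2, a3, a4, hthin⟩ :=
    hPF.exists_unitSq_inter hP hPne (isBounded_unitSq.subset hPsub) hα₀ hL₀
  obtain ⟨G, hG, hG1, hG2⟩ := H α L _ a1 a2 a3 a4 hthin
  obtain ⟨S₂', hS⟩ := exists_reach_diff_biUnion hG hG1 (P ∩ rigid φ w '' UnitSq) UnitSq [P]
    [UnitSq \ closure (rigid φ w '' UnitSq)]
  rw [hG2] at hS
  refine ⟨[], S₂', .head (.reset1 _) (.head (.reset2 _) (.head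
    (.snip2 _ (isRigidMotion_rigid φ w) _) (.head (.undo1 _ _ _ _ _) (.head
    (.snip1 _ isRigidMotion_id _) (.head (.reset2 _) ?_)))))⟩
  simp only [diff_closure_unitSq_diff hPsub]
  exact hS.trans (.head (.undo1 _ _ _ _ _) (.refl _))

theorem realizes_self (P : Set Plane) : Realizes P P := ⟨id, isRigidMotion_id, (image_id P).symm⟩

theorem stmt12 (n m : ℕ) (P₁ P₂ : Set Plane)
    (h₁ : IsPolygonalDomain P₁ n) (h₁sub : P₁ ⊆ UnitSq)
    (h₂ : IsPolygonalDomain P₂ m) (h₂sub : P₂ ⊆ UnitSq) :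
    ∃ s : ℕ, ∃ c : UConfig,
      DUReach 1 s ⟨UnitSq, [], UnitSq, []⟩ c ∧
      Realizes c.T₁ P₁ ∧ Realizes c.T₂ P₂ := by
  obtain ⟨hne₁, -, hreg₁, s₁, hs₁⟩ := h₁
  obtain ⟨hne₂, -, hreg₂, s₂, hs₂⟩ := h₂
  obtain ⟨S₁, S₂, H⟩ := exists_reach_second (P := UnitSq) isOpen_unitSq (hne₁.mono h₁sub)
    subset_rfl hasPolygonalFrontier_unitSq hreg₂ h₂sub ⟨m, s₂, hs₂⟩ [] UnitSq []
  obtain ⟨S₂', S₁', H'⟩ := exists_reach_second (hreg₂ ▸ isOpen_interior) hne₂ h₂sub ⟨m, s₂, hs₂⟩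
    hreg₁ h₁sub ⟨n, s₁, hs₁⟩ S₂ UnitSq S₁
  obtain ⟨s, hs⟩ := H.trans H'.swap
  exact ⟨s, _, hs, realizes_self P₁, realizes_self P₂⟩
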